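/- arXiv:1705.00692 — 2 statements merged into one kernel-verified Lean document; each statement's English description precedes it below -/
import Mathlib

section
/- Let α_{−1} = β_{−1} = 1, let α_0, α_1, … be real numbers, and let β_0, β_1, … be nonnegative real numbers. Suppose the doubly-indexed real numbers x_{j,t} (j ≥ 0, t ≥ 0) satisfy: (i) x_{0,t} ≤ α_0 + t for all t ≥ 0; (ii) x_{j,0} ≤ α_j for all j; (iii) x_{j,t} − x_{j,t−1} ≤ β_{j−1}·x_{j−1,t−1} for all j ≥ 1 and t ≥ 1. Then for all j ≥ 1 and t ≥ 0, x_{j,t} ≤ Σ_{i=0}^{j+1} α_{j−i}·C(t,i)·Π_{s=j−i}^{j−1} β_s. -/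
open Finset

/-- The solution of the extremal recurrence, in which every inequality is an equality. -/
noncomputable def recurrenceBound (α β : ℕ → ℝ) (j t : ℕ) : ℝ :=
  (∑ i ∈ Finset.range (j + 1),
      α (j - i) * (t.choose i : ℝ) * ∏ s ∈ Finset.Ico (j - i) j, β s) +
    (t.choose (j + 1) : ℝ) * ∏ s ∈ Finset.range j, β s

theorem recurrenceBound_zero_left (α β : ℕ → ℝ) (t : ℕ) :
    recurrenceBound α β 0 t = α 0 + t := by
  simp [recurrenceBound]

theorem recurrenceBound_zero_right (α β : ℕ → ℝ) (j : ℕ) :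
    recurrenceBound α β j 0 = α j := by
  simp [recurrenceBound, Finset.sum_range_succ']

theorem recurrenceBound_succ_succ (α β : ℕ → ℝ) (j t : ℕ) :
    recurrenceBound α β (j + 1) (t + 1) =
      recurrenceBound α β (j + 1) t + β j * recurrenceBound α β j t := by
  have hsum : ∑ i ∈ Finset.range (j + 1), α (j - i) * ((t + 1).choose (i + 1) : ℝ) *
        ∏ s ∈ Finset.Ico (j - i) (j + 1), β s =
      ∑ i ∈ Finset.range (j + 1), α (j - i) * (t.choose (i + 1) : ℝ) *
        ∏ s ∈ Finset.Ico (j - i) (j + 1), β s +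
      β j * ∑ i ∈ Finset.range (j + 1), α (j - i) * (t.choose i : ℝ) *
        ∏ s ∈ Finset.Ico (j - i) j, β s := by
    rw [Finset.mul_sum, ← Finset.sum_add_distrib]
    refine Finset.sum_congr rfl fun i _ => ?_
    rw [Finset.prod_Ico_succ_top (Nat.sub_le j i), Nat.choose_succ_succ']
    push_cast
    ring
  simp only [recurrenceBound, Finset.sum_range_succ' _ (j + 1), Nat.add_sub_add_right, hsum,
    Nat.choose_zero_right, Finset.prod_range_succ, Nat.choose_succ_succ' t (j + 1)]
  push_cast
  ring

/-- **Recurrence upper bound.**  Suppose `x_{0,t} ≤ α₀ + t`, `x_{j,0} ≤ α_j`, and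
`x_{j+1,t+1} − x_{j+1,t} ≤ β_j · x_{j,t}` with all `β_j ≥ 0`.  Then for `j ≥ 1`,
`x_{j,t} ≤ Σ_{i=0}^{j+1} α_{j−i}·C(t,i)·Π_{s=j−i}^{j−1} β_s`, where the term `i = j+1`
uses the convention `α_{−1} = β_{−1} = 1` (so it equals `C(t,j+1)·Π_{s=0}^{j−1} β_s`). -/
theorem recurrence_upper_bound
    (α β : ℕ → ℝ) (x : ℕ → ℕ → ℝ)
    (hβ : ∀ s, 0 ≤ β s)
    (h0 : ∀ t : ℕ, x 0 t ≤ α 0 + t)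
    (hinit : ∀ j : ℕ, x j 0 ≤ α j)
    (hrec : ∀ j t : ℕ, x (j + 1) (t + 1) - x (j + 1) t ≤ β j * x j t) :
    ∀ j : ℕ, 1 ≤ j → ∀ t : ℕ,
      x j t ≤
        (∑ i ∈ Finset.range (j + 1),
            α (j - i) * (t.choose i : ℝ) * ∏ s ∈ Finset.Ico (j - i) j, β s) +
          (t.choose (j + 1) : ℝ) * ∏ s ∈ Finset.range j, β s := by
  suffices h : ∀ j t, x j t ≤ recurrenceBound α β j t from fun j _ t => h j t
  intro j
  induction j with
  | zero => exact fun t => (h0 t).trans_eq (recurrenceBound_zero_left α β t).symm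
  | succ j ihj =>
    intro t
    induction t with
    | zero => exact (hinit _).trans_eq (recurrenceBound_zero_right α β _).symm
    | succ t iht =>
      rw [recurrenceBound_succ_succ]
      linarith [hrec j t, mul_le_mul_of_nonneg_left (ihj t) (hβ j)]
end

section
/- Let j* ≥ 0 be an integer, α_{j*} a real number, and β_{j*}, β_{j*+1}, … nonnegative real numbers. Suppose the doubly-indexed real numbers y_{j,t} (j ≥ j*, t ≥ 0) satisfy: (i) y_{j*,t} ≥ α_{j*} for all t ≥ 0; (ii) y_{j,0} ≥ 0 for all j > j*; (iii) y_{j,t} − y_{j,t−1} ≥ β_{j−1}·y_{j−1,t−1} for all j > j* and t ≥ 1. Then for all j ≥ j* and t ≥ 0, y_{j,t} ≥ α_{j*}·C(t, j−j*)·Π_{s=j*}^{j−1} β_s. -/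
open Finset

/-- **Recurrence lower bound.**  Suppose `y_{j*,t} ≥ α_{j*}` for all `t`, `y_{j,0} ≥ 0`
for `j > j*`, and `y_{j,t} − y_{j,t−1} ≥ β_{j−1} · y_{j−1,t−1}` for `j > j*`, `t ≥ 1`,
with all `β_s ≥ 0`.  Then for all `j ≥ j*` and all `t`,
`y_{j,t} ≥ α_{j*}·C(t, j−j*)·Π_{s=j*}^{j−1} β_s`. -/
theorem recurrence_lower_bound
    (jstar : ℕ) (α : ℝ) (β : ℕ → ℝ) (y : ℕ → ℕ → ℝ)
    (hβ : ∀ s, jstar ≤ s → 0 ≤ β s)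
    (hbase : ∀ t : ℕ, α ≤ y jstar t)
    (hinit : ∀ j : ℕ, jstar < j → 0 ≤ y j 0)
    (hrec : ∀ j t : ℕ, jstar < j → 1 ≤ t → β (j - 1) * y (j - 1) (t - 1) ≤ y j t - y j (t - 1)) :
    ∀ j : ℕ, jstar ≤ j → ∀ t : ℕ,
      α * (t.choose (j - jstar) : ℝ) * ∏ s ∈ Finset.Ico jstar j, β s ≤ y j t := by
  intro j hj
  induction j, hj using Nat.le_induction with
  | base => intro t; simpa using hbase t
  | succ j hj ihj =>
    intro t
    induction t with
    | zero => simpa [Nat.sub_add_comm hj] using hinit (j + 1) (by omega)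
    | succ t iht =>
      have hstep := hrec (j + 1) (t + 1) (by omega) (by omega)
      simp only [Nat.add_sub_cancel] at hstep
      have hmul := mul_le_mul_of_nonneg_left (ihj t) (hβ j hj)
      rw [Nat.sub_add_comm hj, Finset.prod_Ico_succ_top hj] at iht ⊢
      rw [Nat.choose_succ_succ]
      push_cast
      linarith
end
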